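/- arXiv:0712.4334 — 3 statements merged into one kernel-verified Lean document; each statement's English description precedes it below -/
import Mathlib

section
/- Let d ≥ 1, let M : ℝ^d → ℝ^d be a linear map that is expansive with constant λ > 1 (i.e. ‖M v‖ ≥ λ‖v‖ for all v), and let Θ ⊆ ℝ^d be a compact set with nonempty interior whose topological boundary has Lebesgue measure zero. Then the sequence (Mⁿ(Θ))ₙ is a Van Hove sequence: for every r > 0, the ratio vol({x ∈ ℝ^d : dist(x, ∂(Mⁿ(Θ))) ≤ r}) / vol(Mⁿ(Θ)) tends to 0 as n → ∞, where Mⁿ(Θ) denotes the image of Θ under the n-fold composition of M and ∂ denotes topological boundary. -/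
open MeasureTheory Filter Topology

/-- If `M : ℝ^d → ℝ^d` is linear and expansive with constant `λ > 1`,
and `Θ ⊆ ℝ^d` is compact with nonempty interior and boundary of Lebesgue measure
zero, then `(Mⁿ(Θ))ₙ` is a Van Hove sequence: for every `r > 0`,
`vol((∂(Mⁿ(Θ)))^{+r}) / vol(Mⁿ(Θ)) → 0` as `n → ∞`. -/
theorem expansive_image_isVanHove
    (d : ℕ) (hd : 1 ≤ d)
    (M : EuclideanSpace ℝ (Fin d) →ₗ[ℝ] EuclideanSpace ℝ (Fin d))
    (lam : ℝ) (hlam : 1 < lam)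
    (hM : ∀ v : EuclideanSpace ℝ (Fin d), lam * ‖v‖ ≤ ‖M v‖)
    (Θ : Set (EuclideanSpace ℝ (Fin d)))
    (hcomp : IsCompact Θ) (hint : (interior Θ).Nonempty)
    (hbd : volume (frontier Θ) = 0) :
    ∀ r : ℝ, 0 < r →
      Tendsto
        (fun n : ℕ =>
          volume {x : EuclideanSpace ℝ (Fin d) |
              Metric.infDist x (frontier ((M ^ n) '' Θ)) ≤ r} /
            volume ((M ^ n) '' Θ))
        atTop (𝓝 0) := by
  intro r hr
  haveI : Nonempty (Fin d) := ⟨⟨0, hd⟩⟩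
  have hl0 : (0:ℝ) < lam := by linarith
  have hpow : ∀ (n : ℕ) (v : EuclideanSpace ℝ (Fin d)), lam ^ n * ‖v‖ ≤ ‖(M ^ n) v‖ := by
    intro n
    induction n with
    | zero => intro v; simp
    | succ k ih =>
      intro v
      rw [pow_succ' M, Module.End.mul_apply]
      calc lam ^ (k + 1) * ‖v‖ = lam * (lam ^ k * ‖v‖) := by ring
        _ ≤ lam * ‖(M ^ k) v‖ := by gcongr; exact ih v
        _ ≤ _ := hM _
  have hinj : ∀ n : ℕ, Function.Injective (M ^ n) := by
    intro n
    rw [injective_iff_map_eq_zero]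
    intro v hv
    have h := hpow n v
    rw [hv, norm_zero] at h
    have h1 : (0:ℝ) < lam ^ n := pow_pos hl0 n
    have h2 : ‖v‖ ≤ 0 := by
      by_contra hc
      push Not at hc
      have := mul_pos h1 hc
      linarith
    exact norm_le_zero_iff.mp h2
  have hFc : IsCompact (frontier Θ) :=
    hcomp.of_isClosed_subset isClosed_frontier hcomp.isClosed.frontier_subset
  have hFne : (frontier Θ).Nonempty := by
    rw [Set.nonempty_iff_ne_empty]
    intro h
    have h1 : IsClopen Θ := isClopen_iff_frontier_eq_empty.mpr h
    rcases isClopen_iff.mp h1 with h2 | h2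
    · rw [h2] at hint; simp at hint
    · exact hcomp.ne_univ h2
  have hfr : ∀ n : ℕ, frontier ((M ^ n) '' Θ) = (M ^ n) '' frontier Θ := by
    intro n
    let e := (LinearEquiv.ofInjectiveEndo (M ^ n) (hinj n)).toContinuousLinearEquiv
    exact (e.toHomeomorph.image_frontier Θ).symm
  have hsub : ∀ n : ℕ, {x : EuclideanSpace ℝ (Fin d) |
      Metric.infDist x (frontier ((M ^ n) '' Θ)) ≤ r} ⊆
      (M ^ n) '' Metric.cthickening (r / lam ^ n) (frontier Θ) := by
    intro n x hx
    rw [hfr n] at hx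
    have hc : IsCompact ((M ^ n) '' frontier Θ) :=
      hFc.image (M ^ n).continuous_of_finiteDimensional
    obtain ⟨_, ⟨y, hy, rfl⟩, hxy⟩ := hc.exists_infDist_eq_dist (hFne.image _) x
    obtain ⟨z, rfl⟩ := (LinearMap.injective_iff_surjective.mp (hinj n)) x
    refine ⟨z, Metric.mem_cthickening_of_dist_le z y _ _ hy ?_, rfl⟩
    have hx' : Metric.infDist ((M ^ n) z) ((M ^ n) '' frontier Θ) ≤ r := hx
    rw [hxy, dist_eq_norm, ← map_sub] at hx'
    rw [dist_eq_norm, le_div_iff₀ (pow_pos hl0 n), mul_comm]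
    exact (hpow n _).trans hx'
  have hvol : volume Θ ≠ 0 :=
    (Measure.measure_pos_of_nonempty_interior volume hint).ne'
  have hlim : Tendsto (fun n : ℕ => volume (Metric.cthickening (r / lam ^ n) (frontier Θ))
      / volume Θ) atTop (𝓝 0) := by
    have h1 : Tendsto (fun n : ℕ => r / lam ^ n) atTop (𝓝 0) :=
      (tendsto_pow_atTop_atTop_of_one_lt hlam).const_div_atTop r
    have h2 := (tendsto_measure_cthickening_of_isCompact (μ := volume) hFc).comp h1
    rw [hbd] at h2
    simpa using ENNReal.Tendsto.div_const h2 (Or.inr hvol)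
  refine tendsto_of_tendsto_of_tendsto_of_le_of_le tendsto_const_nhds hlim
    (fun n => zero_le) (fun n => ?_)
  have hdet : LinearMap.det (M ^ n) ≠ 0 := by
    have := LinearEquiv.isUnit_det' (LinearEquiv.ofInjectiveEndo (M ^ n) (hinj n))
    exact this.ne_zero
  calc _ ≤ volume ((M ^ n) '' Metric.cthickening (r / lam ^ n) (frontier Θ)) /
        volume ((M ^ n) '' Θ) := ENNReal.div_le_div_right (measure_mono (hsub n)) _
    _ = _ := by
      rw [Measure.addHaar_image_linearMap, Measure.addHaar_image_linearMap]
      exact ENNReal.mul_div_mul_left _ _ (by simpa using hdet) ENNReal.ofReal_ne_top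
    _ ≤ _ := le_rfl
end

section
/- Let d ≥ 1 and let T be a collection of nonempty compact subsets of ℝ^d (the tiles) whose union is all of ℝ^d, which is locally finite (every point of ℝ^d has a neighborhood intersecting only finitely many members of T), and which has only finitely many coronas up to translation: there exist finitely many pairs (t₁, C₁), …, (t_m, C_m), where tᵢ ∈ T and Cᵢ = ⋃{s ∈ T : s ∩ tᵢ ≠ ∅}, such that for every t ∈ T there are an index i and a vector v ∈ ℝ^d with t = tᵢ + v and ⋃{s ∈ T : s ∩ t ≠ ∅} = Cᵢ + v. Then there exists a constant η > 0 such that for every y ∈ ℝ^d there is a tile t ∈ T with the open ball B(y, η) contained in ⋃{s ∈ T : s ∩ t ≠ ∅}. -/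
/-- If `T` is a locally finite collection of nonempty compact tiles
covering `ℝ^d` with only finitely many coronas up to translation, then there is
`η > 0` such that every point `y ∈ ℝ^d` has a tile `t ∈ T` whose corona contains
the ball `B(y, η)`. -/
theorem exists_eta_ball_subset_corona
    (d : ℕ) (hd : 1 ≤ d)
    (T : Set (Set (EuclideanSpace ℝ (Fin d))))
    (hne : ∀ t ∈ T, t.Nonempty)
    (hcomp : ∀ t ∈ T, IsCompact t)
    (hcover : ⋃₀ T = Set.univ)
    (hlf : ∀ x : EuclideanSpace ℝ (Fin d), ∃ U ∈ nhds x,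
      {t ∈ T | (t ∩ U).Nonempty}.Finite)
    (hfin : ∃ (m : ℕ) (t' : Fin m → Set (EuclideanSpace ℝ (Fin d))),
      (∀ i, t' i ∈ T) ∧
      ∀ t ∈ T, ∃ (i : Fin m) (v : EuclideanSpace ℝ (Fin d)),
        t = (fun a => a + v) '' t' i ∧
        ⋃₀ {s ∈ T | (s ∩ t).Nonempty} =
          (fun a => a + v) '' ⋃₀ {s ∈ T | (s ∩ t' i).Nonempty}) :
    ∃ η > 0, ∀ y : EuclideanSpace ℝ (Fin d), ∃ t ∈ T,
      Metric.ball y η ⊆ ⋃₀ {s ∈ T | (s ∩ t).Nonempty} := by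
  have key : ∀ t ∈ T, ∃ δ > 0, Metric.thickening δ t ⊆ ⋃₀ {s ∈ T | (s ∩ t).Nonempty} := by
    intro t ht
    have hsub : t ⊆ interior (⋃₀ {s ∈ T | (s ∩ t).Nonempty}) := by
      intro x hx
      rw [mem_interior_iff_mem_nhds]
      obtain ⟨U, hU, hF⟩ := hlf x
      have h1 : ∀ᶠ z in nhds x, ∀ s ∈ {s ∈ T | (s ∩ U).Nonempty}, z ∈ s → x ∈ s := by
        rw [Filter.eventually_all_finite hF]
        intro s hs
        by_cases hxs : x ∈ s
        · exact Filter.Eventually.of_forall fun _ _ => hxs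
        · filter_upwards [(hcomp s hs.1).isClosed.isOpen_compl.mem_nhds hxs] with z hz hz'
          exact absurd hz' hz
      filter_upwards [h1, hU] with z hz hzU
      have hzc : z ∈ ⋃₀ T := by rw [hcover]; trivial
      obtain ⟨s, hs, hzs⟩ := hzc
      exact ⟨s, ⟨hs, x, hz s ⟨hs, z, hzs, hzU⟩ hzs, hx⟩, hzs⟩
    obtain ⟨δ, hδ, h⟩ := (hcomp t ht).exists_thickening_subset_open isOpen_interior hsub
    exact ⟨δ, hδ, h.trans interior_subset⟩
  obtain ⟨m, t', ht', hall⟩ := hfin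
  choose δ hδ hδs using fun i => key (t' i) (ht' i)
  have hη : ∀ᶠ η : ℝ in nhdsWithin 0 (Set.Ioi 0), ∀ i, η < δ i := by
    rw [Filter.eventually_all]
    intro i
    exact nhdsWithin_le_nhds (Iio_mem_nhds (hδ i))
  obtain ⟨η, hη1, hη0⟩ := (hη.and self_mem_nhdsWithin).exists
  refine ⟨η, hη0, fun y => ?_⟩
  have hyc : y ∈ ⋃₀ T := by rw [hcover]; trivial
  obtain ⟨t, ht, hyt⟩ := hyc
  refine ⟨t, ht, ?_⟩
  obtain ⟨i, v, h1, h2⟩ := hall t ht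
  rw [h2]
  rw [h1] at hyt
  obtain ⟨a, ha, rfl⟩ := hyt
  intro z hz
  refine ⟨z - v, hδs i ?_, by simp⟩
  rw [Metric.mem_thickening_iff]
  refine ⟨a, ha, lt_trans ?_ (hη1 i)⟩
  rw [Metric.mem_ball, dist_eq_norm] at hz
  rw [dist_eq_norm]
  have e : z - v - a = z - (a + v) := by abel
  rw [e]
  exact hz
end

section
/- Let λ₁ > 1 and λ₂ > 1 be real numbers, let F₁ and F₂ be finite sets of real numbers, and let u : ℕ → ℝ be an injective sequence such that for every n there exist f₁ ∈ F₁, f₂ ∈ F₂ and natural numbers k₁, k₂ with u(n) = f₁ / λ₁^{k₁} and u(n) = f₂ / λ₂^{k₂}. Then λ₁ and λ₂ are multiplicatively dependent: there exist positive integers p and q with λ₁^p = λ₂^q. -/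
lemma aux_dep (a b : ℝ) (ha : 1 < a) (hb : 1 < b) (f g : ℝ) (hf : f ≠ 0) (k d l m : ℕ)
    (hd : 0 < d) (e₁ : f / a ^ k = g / b ^ l) (e₂ : f / a ^ (k + d) = g / b ^ m) :
    ∃ p q : ℕ, 0 < p ∧ 0 < q ∧ a ^ p = b ^ q := by
  have a0 : a ≠ 0 := by positivity
  have b0 : b ≠ 0 := by positivity
  have hg : g ≠ 0 := by
    rintro rfl
    rw [zero_div] at e₁
    exact (div_ne_zero hf (pow_ne_zero k a0)) e₁
  have key : b ^ m = a ^ d * b ^ l := by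
    have e₃ : f / a ^ k = a ^ d * (g / b ^ m) := by
      rw [← e₂, pow_add]; field_simp
    rw [e₁] at e₃
    field_simp at e₃
    linarith
  have had : 1 < a ^ d := one_lt_pow₀ ha hd.ne'
  have bl : 0 < b ^ l := by positivity
  have hlm : l < m := by
    by_contra hc
    have : b ^ m ≤ b ^ l := pow_le_pow_right₀ hb.le (not_lt.mp hc)
    nlinarith
  obtain ⟨q, rfl⟩ := Nat.exists_eq_add_of_lt hlm
  refine ⟨d, q + 1, hd, q.succ_pos, ?_⟩
  apply mul_right_cancel₀ bl.ne'
  rw [← key]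
  ring

/-- If `λ₁, λ₂ > 1`, `F₁, F₂` are finite sets of reals, and
`u : ℕ → ℝ` is an injective sequence each of whose values has the form
`f₁ / λ₁^{k₁} = f₂ / λ₂^{k₂}` with `fᵢ ∈ Fᵢ`, then `λ₁` and `λ₂` are
multiplicatively dependent: `λ₁^p = λ₂^q` for some positive integers `p, q`. -/
theorem multiplicatively_dependent_of_common_frequencies
    (lam₁ lam₂ : ℝ) (h₁ : 1 < lam₁) (h₂ : 1 < lam₂)
    (F₁ F₂ : Finset ℝ) (u : ℕ → ℝ) (hu : Function.Injective u)
    (h : ∀ n : ℕ, ∃ f₁ ∈ F₁, ∃ f₂ ∈ F₂, ∃ k₁ k₂ : ℕ,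
      u n = f₁ / lam₁ ^ k₁ ∧ u n = f₂ / lam₂ ^ k₂) :
    ∃ p q : ℕ, 0 < p ∧ 0 < q ∧ lam₁ ^ p = lam₂ ^ q := by
  choose f₁ hf₁ f₂ hf₂ k₁ k₂ e₁ e₂ using h
  obtain ⟨n, m, hnm, he⟩ := Finite.exists_ne_map_eq_of_infinite
    (fun n => ((⟨f₁ n, hf₁ n⟩, ⟨f₂ n, hf₂ n⟩) : F₁ × F₂))
  simp only [Prod.mk.injEq, Subtype.mk.injEq] at he
  obtain ⟨he₁, he₂⟩ := he
  have hne : u n ≠ u m := fun hc => hnm (hu hc)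
  have hf : f₁ n ≠ 0 := by
    intro h0
    apply hne
    rw [e₁ n, e₁ m, ← he₁, h0]
    simp
  have hk : k₁ n ≠ k₁ m := by
    intro h0
    apply hne
    rw [e₁ n, e₁ m, ← he₁, h0]
  have A : f₁ n / lam₁ ^ k₁ n = f₂ n / lam₂ ^ k₂ n := (e₁ n).symm.trans (e₂ n)
  have B : f₁ n / lam₁ ^ k₁ m = f₂ n / lam₂ ^ k₂ m := by
    rw [he₁, he₂]; exact (e₁ m).symm.trans (e₂ m)
  rcases lt_or_gt_of_ne hk with hlt | hlt
  · exact aux_dep lam₁ lam₂ h₁ h₂ _ _ hf (k₁ n) (k₁ m - k₁ n) _ _ (by omega) A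
      (by rw [Nat.add_sub_cancel' hlt.le]; exact B)
  · exact aux_dep lam₁ lam₂ h₁ h₂ _ _ hf (k₁ m) (k₁ n - k₁ m) _ _ (by omega) B
      (by rw [Nat.add_sub_cancel' hlt.le]; exact A)
end
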